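/- arXiv:1109.0699 — 2 statements merged into one kernel-verified Lean document; each statement's English description precedes it below -/
import Mathlib

section
/- Let T be a set of coherent sequents, i.e. L-sentences of the form ∀x₁…∀xₙ(φ → ψ) with φ, ψ coherent formulas with free variables among x₁,…,xₙ. Then the space I_T of isomorphisms between S-indexed models of T, with the subspace logical topology, is a sober topological space. -/
open FirstOrder Language Set Topology TopologicalSpace Cardinal

universe u v w

namespace SemGpd

variable (L : FirstOrder.Language.{u, v}) (S : Type w)

/-- An `S`-indexed `L`-structure: a subset `A ⊆ S`, an equivalence relation `≈` on `A`,
and an `L`-structure on the quotient `A/≈`. -/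
structure IndexedStructure where
  A : Set S
  r : Setoid A
  str : L.Structure (Quotient r)

variable {L S}

/-- The underlying set (carrier) `A/≈` of an indexed structure. -/
abbrev IndexedStructure.carrier (M : IndexedStructure L S) : Type w := Quotient M.r

/-- The equivalence class of an indexed element. -/
def IndexedStructure.cls (M : IndexedStructure L S) (a : S) (h : a ∈ M.A) : M.carrier :=
  Quotient.mk M.r ⟨a, h⟩

/-- Satisfaction of a formula in an indexed structure under an assignment. -/
def IndexedStructure.Sat (M : IndexedStructure L S) {α : Type*} (φ : L.Formula α)
    (v : α → M.carrier) : Prop :=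
  letI := M.str
  φ.Realize v

/-- Satisfaction of a sentence in an indexed structure. -/
def IndexedStructure.SatSentence (M : IndexedStructure L S) (σ : L.Sentence) : Prop :=
  letI := M.str
  M.carrier ⊨ σ

/-- `M` is an `S`-indexed model of the theory `T`. -/
def IndexedStructure.models (M : IndexedStructure L S) (T : Set L.Sentence) : Prop :=
  ∀ σ ∈ T, M.SatSentence σ

variable (L S)

/-- The basic set `⟨φ, a⟩` of indexed structures. -/
def fSet {n : ℕ} (φ : L.Formula (Fin n)) (a : Fin n → S) : Set (IndexedStructure L S) :=
  {M | ∃ h : ∀ i, a i ∈ M.A, M.Sat φ fun i => M.cls (a i) (h i)}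

/-- The basic set `⟨a⟩` of structures in which `a` is indexed. -/
def membSet (a : S) : Set (IndexedStructure L S) :=
  {M | a ∈ M.A}

/-- The logical topology on the space of `S`-indexed `L`-structures, generated by the
membership conditions `⟨a⟩` and the atomic conditions `⟨φ, a⟩` for `φ` atomic (which include
the relation conditions `⟨R,a⟩`, the function conditions `⟨f(a)=b⟩` and equality conditions). -/
def logicalTopology : TopologicalSpace (IndexedStructure L S) :=
  generateFrom {U | (∃ a : S, U = membSet L S a) ∨
    ∃ (n : ℕ) (φ : L.Formula (Fin n)), BoundedFormula.IsAtomic φ ∧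
      ∃ a : Fin n → S, U = fSet L S φ a}

instance : TopologicalSpace (IndexedStructure L S) := logicalTopology L S

/-- An isomorphism between `S`-indexed `L`-structures. -/
structure IndexedIso where
  dom : IndexedStructure L S
  cod : IndexedStructure L S
  iso : @Language.Equiv L dom.carrier cod.carrier dom.str cod.str

variable {L S}

/-- Application of an isomorphism of indexed structures to an element of the domain. -/
def IndexedIso.map (F : IndexedIso L S) (x : F.dom.carrier) : F.cod.carrier :=
  (@Language.Equiv.toEquiv L F.dom.carrier F.cod.carrier F.dom.str F.cod.str F.iso) x

/-- The basic set `⟨a ↦ b⟩` of isomorphisms. -/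
def mapSet (a b : S) : Set (IndexedIso L S) :=
  {F | ∃ (ha : a ∈ F.dom.A) (hb : b ∈ F.cod.A),
    F.map (F.dom.cls a ha) = F.cod.cls b hb}

variable (L S)

/-- The logical topology on the space of isomorphisms of `S`-indexed `L`-structures:
the coarsest topology making `dom` and `cod` continuous and containing each `⟨a ↦ b⟩`. -/
def isoTopology : TopologicalSpace (IndexedIso L S) :=
  ((logicalTopology L S).induced IndexedIso.dom) ⊓
    ((logicalTopology L S).induced IndexedIso.cod) ⊓
    generateFrom {V | ∃ a b : S, V = mapSet a b}

instance : TopologicalSpace (IndexedIso L S) := isoTopology L S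

variable {L S}

/-- The identity isomorphism. -/
def idIso (M : IndexedStructure L S) : IndexedIso L S :=
  ⟨M, M, by letI := M.str; exact Language.Equiv.refl L M.carrier⟩

/-- The inverse of an isomorphism of indexed structures. -/
def IndexedIso.inv (F : IndexedIso L S) : IndexedIso L S :=
  ⟨F.cod, F.dom, by letI := F.dom.str; letI := F.cod.str; exact F.iso.symm⟩

/-- The composite of two composable isomorphisms of indexed structures. -/
def IndexedIso.comp (F G : IndexedIso L S) (h : F.cod = G.dom) : IndexedIso L S :=
  ⟨F.dom, G.cod, by
    letI := F.dom.str; letI := F.cod.str; letI := G.cod.str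
    exact Language.Equiv.comp (by rw [h]; exact G.iso) F.iso⟩

variable (L S)

/-- The space of composable pairs of isomorphisms, as a subspace of the product. -/
def CompPairs := {p : IndexedIso L S × IndexedIso L S // p.1.cod = p.2.dom}

instance : TopologicalSpace (CompPairs L S) :=
  instTopologicalSpaceSubtype

/-- The space `M_T` of `S`-indexed models of `T`, as a subspace of `M_L`. -/
abbrev ModelsT (T : Set L.Sentence) := {M : IndexedStructure L S // M.models T}

/-- The space `I_T` of isomorphisms between `S`-indexed models of `T`, as a subspace of `I_L`. -/
abbrev IsoT (T : Set L.Sentence) := {F : IndexedIso L S // F.dom.models T ∧ F.cod.models T}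

variable {L S}

/-- The domain map `d : I_T → M_T`. -/
def IsoT.d {T : Set L.Sentence} (F : IsoT L S T) : ModelsT L S T := ⟨F.1.dom, F.2.1⟩

/-- The codomain map `c : I_T → M_T`. -/
def IsoT.c {T : Set L.Sentence} (F : IsoT L S T) : ModelsT L S T := ⟨F.1.cod, F.2.2⟩

/-- Horn formulas: finite conjunctions of atomic formulas (including `⊤`). -/
inductive IsHorn {α : Type*} : ∀ {n : ℕ}, L.BoundedFormula α n → Prop
  | top {n : ℕ} : IsHorn (⊤ : L.BoundedFormula α n)
  | equal {n : ℕ} (t₁ t₂ : L.Term (α ⊕ Fin n)) : IsHorn (t₁.bdEqual t₂)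
  | rel {n k : ℕ} (R : L.Relations k) (ts : Fin k → L.Term (α ⊕ Fin n)) :
      IsHorn (R.boundedFormula ts)
  | inf {n : ℕ} {φ ψ : L.BoundedFormula α n} : IsHorn φ → IsHorn ψ → IsHorn (φ ⊓ ψ)

/-- Coherent formulas: built from atomic formulas, `⊤` and `⊥` by `∧`, `∨` and `∃`. -/
inductive IsCoherent {α : Type*} : ∀ {n : ℕ}, L.BoundedFormula α n → Prop
  | falsum {n : ℕ} : IsCoherent (⊥ : L.BoundedFormula α n)
  | top {n : ℕ} : IsCoherent (⊤ : L.BoundedFormula α n)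
  | equal {n : ℕ} (t₁ t₂ : L.Term (α ⊕ Fin n)) : IsCoherent (t₁.bdEqual t₂)
  | rel {n k : ℕ} (R : L.Relations k) (ts : Fin k → L.Term (α ⊕ Fin n)) :
      IsCoherent (R.boundedFormula ts)
  | inf {n : ℕ} {φ ψ : L.BoundedFormula α n} : IsCoherent φ → IsCoherent ψ → IsCoherent (φ ⊓ ψ)
  | sup {n : ℕ} {φ ψ : L.BoundedFormula α n} : IsCoherent φ → IsCoherent ψ → IsCoherent (φ ⊔ ψ)
  | ex {n : ℕ} {φ : L.BoundedFormula α (n + 1)} : IsCoherent φ → IsCoherent φ.ex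

/-- A coherent sequent: a sentence of the form `∀ x₁ … xₙ (φ → ψ)` with `φ, ψ` coherent. -/
def IsCoherentSequent (σ : L.Sentence) : Prop :=
  ∃ (n : ℕ) (φ ψ : L.BoundedFormula Empty n),
    IsCoherent φ ∧ IsCoherent ψ ∧ σ = (φ.imp ψ).alls


variable (L S)

/-- The sheaf `D_φ` of realizations of `φ` over the space of `S`-indexed models of `T`. -/
structure DSet (T : Set L.Sentence) {n : ℕ} (φ : L.Formula (Fin n)) where
  str : IndexedStructure L S
  mods : str.models T
  tup : Fin n → str.carrier
  sat : str.Sat φ tup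

variable {L S}

/-- The projection `π₁ : D_φ → M_T`. -/
def DSet.pi {T : Set L.Sentence} {n : ℕ} {φ : L.Formula (Fin n)} (d : DSet L S T φ) :
    ModelsT L S T := ⟨d.str, d.mods⟩

variable (L S)

/-- The image of the section `s_a : ⟨φ,a⟩ ∩ M_T → D_φ`. -/
def secImage (T : Set L.Sentence) {n : ℕ} (φ : L.Formula (Fin n)) (a : Fin n → S) :
    Set (DSet L S T φ) :=
  {d | ∃ h : ∀ i, a i ∈ d.str.A, d.tup = fun i => d.str.cls (a i) (h i)}

/-- The logical topology on `D_φ`: the coarsest topology making `π₁` continuous and making the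
image of every section `s_a` open. -/
def dTopology (T : Set L.Sentence) {n : ℕ} (φ : L.Formula (Fin n)) :
    TopologicalSpace (DSet L S T φ) :=
  (TopologicalSpace.induced DSet.pi inferInstance) ⊓
    generateFrom {V | ∃ a : Fin n → S, V = secImage L S T φ a}

instance {T : Set L.Sentence} {n : ℕ} {φ : L.Formula (Fin n)} :
    TopologicalSpace (DSet L S T φ) := dTopology L S T φ

/-- The basic open set `⟨ψ, b⟩` of `D_φ`. -/
def dBasic (T : Set L.Sentence) {n : ℕ} (φ : L.Formula (Fin n)) {m : ℕ}
    (ψ : L.Formula (Fin n ⊕ Fin m)) (b : Fin m → S) : Set (DSet L S T φ) :=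
  {d | ∃ h : ∀ j, b j ∈ d.str.A,
    d.str.Sat ψ (Sum.elim d.tup fun j => d.str.cls (b j) (h j))}

/-- The fiber product `I_T ×_{M_T} D_φ` of composable pairs for the application action. -/
def ActPairs (T : Set L.Sentence) {n : ℕ} (φ : L.Formula (Fin n)) :=
  {p : IsoT L S T × DSet L S T φ // p.1.1.dom = p.2.str}

instance {T : Set L.Sentence} {n : ℕ} {φ : L.Formula (Fin n)} :
    TopologicalSpace (ActPairs L S T φ) := instTopologicalSpaceSubtype

variable {L S}

/-- Isomorphisms of indexed structures preserve satisfaction. -/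
theorem IndexedIso.sat_map (F : IndexedIso L S) {α : Type*} (φ : L.Formula α)
    (v : α → F.dom.carrier) (h : F.dom.Sat φ v) :
    F.cod.Sat φ fun i => F.map (v i) := by
  letI := F.dom.str
  letI := F.cod.str
  have := (StrongHomClass.realize_formula (F.iso) φ (v := v)).mpr h
  exact this

/-- Transport of satisfaction along an equality of indexed structures. -/
theorem sat_cast {M N : IndexedStructure L S} (h : M = N) {α : Type*} (φ : L.Formula α)
    (v : α → N.carrier) (hs : N.Sat φ v) :
    M.Sat φ fun i => cast (congrArg IndexedStructure.carrier h.symm) (v i) := by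
  subst h; exact hs

/-- The application action `θ : I_T ×_{M_T} D_φ → D_φ`. -/
def act {T : Set L.Sentence} {n : ℕ} {φ : L.Formula (Fin n)} (p : ActPairs L S T φ) :
    DSet L S T φ where
  str := p.1.1.1.cod
  mods := p.1.1.2.2
  tup := fun i =>
    p.1.1.1.map (cast (congrArg IndexedStructure.carrier p.2.symm) (p.1.2.tup i))
  sat := p.1.1.1.sat_map φ _ (sat_cast p.2 φ p.1.2.tup p.1.2.sat)

/-- A subset of `D_φ` is stable if it is closed under the application action. -/
def Stable {T : Set L.Sentence} {n : ℕ} {φ : L.Formula (Fin n)}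
    (X : Set (DSet L S T φ)) : Prop :=
  ∀ p : ActPairs L S T φ, p.1.2 ∈ X → act p ∈ X

/-- The stabilization of a subset of `D_φ`: the smallest stable subset containing it. -/
def stabilization {T : Set L.Sentence} {n : ℕ} {φ : L.Formula (Fin n)}
    (X : Set (DSet L S T φ)) : Set (DSet L S T φ) :=
  ⋂₀ {Y | X ⊆ Y ∧ Stable Y}

/-- The set `{(M,m) ∈ D_φ : M ⊨ ∃y ψ(m,y)}`. -/
def exSet {T : Set L.Sentence} {n : ℕ} (φ : L.Formula (Fin n)) {m : ℕ}
    (ψ : L.Formula (Fin n ⊕ Fin m)) : Set (DSet L S T φ) :=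
  {d | ∃ w : Fin m → d.str.carrier, d.str.Sat ψ (Sum.elim d.tup w)}

/-- The identity isomorphism on a model of `T`, as an element of `I_T`. -/
def idIsoT {T : Set L.Sentence} (M : ModelsT L S T) : IsoT L S T :=
  ⟨idIso M.1, M.2, M.2⟩

/-- The inverse, in `I_T`. -/
def IsoT.inv {T : Set L.Sentence} (F : IsoT L S T) : IsoT L S T :=
  ⟨F.1.inv, F.2.2, F.2.1⟩

/-- The composite, in `I_T`. -/
def IsoT.comp {T : Set L.Sentence} (F G : IsoT L S T) (h : F.1.cod = G.1.dom) : IsoT L S T :=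
  ⟨F.1.comp G.1 h, F.2.1, G.2.2⟩



variable {L : FirstOrder.Language.{u, v}} {S : Type w}

instance (M : IndexedStructure L S) : L.Structure M.carrier := M.str

/-- The index `a` names the element `x` of the indexed structure `M`. -/
def IndexedStructure.Names (M : IndexedStructure L S) (a : S) (x : M.carrier) : Prop :=
  ∃ h : a ∈ M.A, M.cls a h = x

section Names

variable {M : IndexedStructure L S}

theorem IndexedStructure.Names.unique {a : S} {x y : M.carrier} (hx : M.Names a x)
    (hy : M.Names a y) : x = y := by
  obtain ⟨_, rfl⟩ := hx
  obtain ⟨_, rfl⟩ := hy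
  rfl

theorem IndexedStructure.Names.unique_pi {ι : Type*} {a : ι → S} {x y : ι → M.carrier}
    (hx : ∀ i, M.Names (a i) (x i)) (hy : ∀ i, M.Names (a i) (y i)) : x = y :=
  funext fun i => (hx i).unique (hy i)

theorem IndexedStructure.exists_names (x : M.carrier) : ∃ a, M.Names a x := by
  induction x using Quotient.inductionOn with
  | h a => exact ⟨a.1, a.2, rfl⟩

theorem IndexedStructure.exists_names_pi {ι : Type*} (x : ι → M.carrier) :
    ∃ a : ι → S, ∀ i, M.Names (a i) (x i) := by
  choose a ha using fun i => M.exists_names (x i)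
  exact ⟨a, ha⟩

end Names

/-- The structures in which `a` and `b` name the same element. -/
def eqSet (L : FirstOrder.Language.{u, v}) {S : Type w} (a b : S) :
    Set (IndexedStructure L S) :=
  {M | ∃ x, M.Names a x ∧ M.Names b x}

/-- The basic set `⟨R,a⟩`. -/
def relSet {n : ℕ} (R : L.Relations n) (a : Fin n → S) : Set (IndexedStructure L S) :=
  {M | ∃ x : Fin n → M.carrier, (∀ i, M.Names (a i) (x i)) ∧ Structure.RelMap R x}

/-- The basic set `⟨f(a)=b⟩`. -/
def funSet {n : ℕ} (f : L.Functions n) (a : Fin n → S) (b : S) :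
    Set (IndexedStructure L S) :=
  {M | ∃ x : Fin n → M.carrier, (∀ i, M.Names (a i) (x i)) ∧
    M.Names b (Structure.funMap f x)}

/-- The structures in which the value of the term `t` at `a` is named by `b`. -/
def termSet {β : Type*} (t : L.Term β) (a : β → S) (b : S) : Set (IndexedStructure L S) :=
  {M | ∃ x : β → M.carrier, (∀ i, M.Names (a i) (x i)) ∧ M.Names b (t.realize x)}

/-- The structures in which `φ` holds of the elements named by `a` and `b`. -/
def boundedSet {α : Type*} {n : ℕ} (φ : L.BoundedFormula α n) (a : α → S) (b : Fin n → S) :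
    Set (IndexedStructure L S) :=
  {M | ∃ (x : α → M.carrier) (y : Fin n → M.carrier), (∀ i, M.Names (a i) (x i)) ∧
    (∀ i, M.Names (b i) (y i)) ∧ φ.Realize x y}

theorem fSet_eq_boundedSet {n : ℕ} (φ : L.Formula (Fin n)) (a : Fin n → S) :
    fSet L S φ a = boundedSet φ a default := by
  ext M
  constructor
  · rintro ⟨h, hs⟩
    exact ⟨fun i => M.cls (a i) (h i), default, fun i => ⟨h i, rfl⟩, fun i => i.elim0, hs⟩
  · rintro ⟨x, y, hx, -, hs⟩
    have h : ∀ i, a i ∈ M.A := fun i => (hx i).1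
    have e : x = fun i => M.cls (a i) (h i) :=
      IndexedStructure.Names.unique_pi hx fun i => ⟨h i, rfl⟩
    subst e
    obtain rfl : y = default := Subsingleton.elim _ _
    exact ⟨h, hs⟩

variable (L S) in
/-- The generators of the logical topology given by unnested atomic conditions. -/
inductive IsSubbasic : Set (IndexedStructure L S) → Prop
  | eq (a b : S) : IsSubbasic (eqSet L a b)
  | rel {n : ℕ} (R : L.Relations n) (a : Fin n → S) : IsSubbasic (relSet R a)
  | func {n : ℕ} (f : L.Functions n) (a : Fin n → S) (b : S) : IsSubbasic (funSet f a b)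

section Open

variable [t : TopologicalSpace (IndexedStructure L S)]

theorem isOpen_setOf_names (hU : ∀ U, IsSubbasic L S U → IsOpen U) {ι : Type*} [Finite ι]
    (a : ι → S) :
    IsOpen {M : IndexedStructure L S | ∃ x : ι → M.carrier, ∀ i, M.Names (a i) (x i)} := by
  have : {M : IndexedStructure L S | ∃ x : ι → M.carrier, ∀ i, M.Names (a i) (x i)} =
      ⋂ i, eqSet L (a i) (a i) := by
    ext M
    simp only [eqSet, and_self, mem_ofPred_eq, mem_iInter]
    exact Classical.skolem.symm
  rw [this]
  exact isOpen_iInter_of_finite fun i => hU _ (.eq _ _)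

theorem isOpen_termSet (hU : ∀ U, IsSubbasic L S U → IsOpen U) {β : Type*} [Finite β]
    (t : L.Term β) (a : β → S) (b : S) : IsOpen (termSet t a b) := by
  induction t generalizing b with
  | var i =>
    have : termSet (Term.var i : L.Term β) a b =
        {M | ∃ x : β → M.carrier, ∀ i, M.Names (a i) (x i)} ∩ eqSet L (a i) b := by
      ext M
      constructor
      · rintro ⟨x, hx, hb⟩
        exact ⟨⟨x, hx⟩, x i, hx i, hb⟩
      · rintro ⟨⟨x, hx⟩, y, hy, hb⟩
        refine ⟨x, hx, ?_⟩
        rwa [Term.realize_var, (hx i).unique hy]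
    rw [this]
    exact (isOpen_setOf_names hU a).inter (hU _ (.eq _ _))
  | @func n f ts ih =>
    have : termSet (Term.func f ts) a b = {M | ∃ x : β → M.carrier, ∀ i, M.Names (a i) (x i)} ∩
        ⋃ c : Fin n → S, (⋂ i, termSet (ts i) a (c i)) ∩ funSet f c b := by
      ext M
      simp only [mem_inter_iff, mem_iUnion, mem_iInter]
      constructor
      · rintro ⟨x, hx, hb⟩
        obtain ⟨c, hc⟩ := M.exists_names_pi fun i => (ts i).realize x
        exact ⟨⟨x, hx⟩, c, fun i => ⟨x, hx, hc i⟩, _, hc, hb⟩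
      · rintro ⟨⟨x, hx⟩, c, hc, y, hy, hb⟩
        refine ⟨x, hx, ?_⟩
        have : y = fun i => (ts i).realize x := by
          refine IndexedStructure.Names.unique_pi hy fun i => ?_
          obtain ⟨x', hx', h⟩ := hc i
          rwa [IndexedStructure.Names.unique_pi hx hx']
        subst this
        exact hb
    rw [this]
    exact (isOpen_setOf_names hU a).inter (isOpen_iUnion fun c =>
      (isOpen_iInter_of_finite fun i => ih i _).inter (hU _ (.func _ _ _)))

theorem isOpen_boundedSet (hU : ∀ U, IsSubbasic L S U → IsOpen U) {α : Type*} [Finite α]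
    {n : ℕ} {φ : L.BoundedFormula α n} (hφ : IsCoherent φ) (a : α → S) (b : Fin n → S) :
    IsOpen (boundedSet φ a b) := by
  have names_elim : ∀ {n : ℕ} {b : Fin n → S} {M : IndexedStructure L S} {x : α → M.carrier}
      {y : Fin n → M.carrier}, (∀ i, M.Names (a i) (x i)) → (∀ i, M.Names (b i) (y i)) →
      ∀ i, M.Names (Sum.elim a b i) (Sum.elim x y i) := by
    rintro n b M x y hx hy (i | i)
    exacts [hx i, hy i]
  induction hφ with
  | falsum =>
    convert isOpen_empty
    ext M
    simp [boundedSet]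
  | top =>
    convert isOpen_setOf_names hU (Sum.elim a b)
    rename_i M
    ext M
    constructor
    · rintro ⟨x, y, hx, hy, -⟩
      exact ⟨Sum.elim x y, names_elim hx hy⟩
    · rintro ⟨z, hz⟩
      exact ⟨z ∘ Sum.inl, z ∘ Sum.inr, fun i => hz (.inl i), fun i => hz (.inr i),
        BoundedFormula.realize_top.2 trivial⟩
  | @equal n t₁ t₂ =>
    have : boundedSet (t₁.bdEqual t₂) a b =
        ⋃ c, termSet t₁ (Sum.elim a b) c ∩ termSet t₂ (Sum.elim a b) c := by
      ext M
      simp only [mem_iUnion]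
      constructor
      · rintro ⟨x, y, hx, hy, h⟩
        rw [BoundedFormula.realize_bdEqual] at h
        obtain ⟨c, hc⟩ := M.exists_names (t₁.realize (Sum.elim x y))
        exact ⟨c, ⟨_, names_elim hx hy, hc⟩, ⟨_, names_elim hx hy, h ▸ hc⟩⟩
      · rintro ⟨c, ⟨z, hz, h₁⟩, ⟨z', hz', h₂⟩⟩
        obtain rfl := IndexedStructure.Names.unique_pi hz hz'
        refine ⟨z ∘ Sum.inl, z ∘ Sum.inr, fun i => hz (.inl i), fun i => hz (.inr i), ?_⟩
        rw [BoundedFormula.realize_bdEqual, Sum.elim_comp_inl_inr]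
        exact h₁.unique h₂
    rw [this]
    exact isOpen_iUnion fun c => (isOpen_termSet hU _ _ _).inter (isOpen_termSet hU _ _ _)
  | @rel n k R ts =>
    have : boundedSet (R.boundedFormula ts) a b =
        {M | ∃ x : α ⊕ Fin n → M.carrier, ∀ i, M.Names (Sum.elim a b i) (x i)} ∩
        ⋃ c : Fin k → S, (⋂ i, termSet (ts i) (Sum.elim a b) (c i)) ∩ relSet R c := by
      ext M
      simp only [mem_inter_iff, mem_iUnion, mem_iInter]
      constructor
      · rintro ⟨x, y, hx, hy, h⟩
        rw [BoundedFormula.realize_rel] at h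
        obtain ⟨c, hc⟩ := M.exists_names_pi fun i => (ts i).realize (Sum.elim x y)
        exact ⟨⟨_, names_elim hx hy⟩, c, fun i => ⟨_, names_elim hx hy, hc i⟩, _, hc, h⟩
      · rintro ⟨⟨z, hz⟩, c, hc, w, hw, h⟩
        refine ⟨z ∘ Sum.inl, z ∘ Sum.inr, fun i => hz (.inl i), fun i => hz (.inr i), ?_⟩
        rw [BoundedFormula.realize_rel, Sum.elim_comp_inl_inr]
        convert h using 1
        refine IndexedStructure.Names.unique_pi (fun i => ?_) hw
        obtain ⟨z', hz', h'⟩ := hc i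
        rwa [IndexedStructure.Names.unique_pi hz hz']
    rw [this]
    exact (isOpen_setOf_names hU _).inter (isOpen_iUnion fun c =>
      (isOpen_iInter_of_finite fun i => isOpen_termSet hU _ _ _).inter (hU _ (.rel _ _)))
  | @inf n φ ψ _ _ ihφ ihψ =>
    convert (ihφ b).inter (ihψ b)
    ext M
    constructor
    · rintro ⟨x, y, hx, hy, h⟩
      rw [BoundedFormula.realize_inf] at h
      exact ⟨⟨x, y, hx, hy, h.1⟩, ⟨x, y, hx, hy, h.2⟩⟩
    · rintro ⟨⟨x, y, hx, hy, h⟩, ⟨x', y', hx', hy', h'⟩⟩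
      obtain rfl := IndexedStructure.Names.unique_pi hx hx'
      obtain rfl := IndexedStructure.Names.unique_pi hy hy'
      exact ⟨x, y, hx, hy, BoundedFormula.realize_inf.2 ⟨h, h'⟩⟩
  | @sup n φ ψ _ _ ihφ ihψ =>
    convert (ihφ b).union (ihψ b)
    ext M
    constructor
    · rintro ⟨x, y, hx, hy, h⟩
      exact (BoundedFormula.realize_sup.1 h).imp (fun h => ⟨x, y, hx, hy, h⟩)
        fun h => ⟨x, y, hx, hy, h⟩
    · rintro (⟨x, y, hx, hy, h⟩ | ⟨x, y, hx, hy, h⟩)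
      exacts [⟨x, y, hx, hy, BoundedFormula.realize_sup.2 (.inl h)⟩,
        ⟨x, y, hx, hy, BoundedFormula.realize_sup.2 (.inr h)⟩]
  | @ex n φ _ ih =>
    have : boundedSet φ.ex a b = ⋃ c : S, boundedSet φ a (Fin.snoc b c) := by
      ext M
      simp only [mem_iUnion]
      constructor
      · rintro ⟨x, y, hx, hy, h⟩
        obtain ⟨z, hz⟩ := BoundedFormula.realize_ex.1 h
        obtain ⟨c, hc⟩ := M.exists_names z
        refine ⟨c, x, Fin.snoc y z, hx, Fin.lastCases ?_ fun i => ?_, hz⟩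
        · simpa using hc
        · simpa using hy i
      · rintro ⟨c, x, y, hx, hy, h⟩
        refine ⟨x, Fin.init y, hx, fun i => ?_, BoundedFormula.realize_ex.2 ⟨y (Fin.last n), ?_⟩⟩
        · simpa [Fin.init_def] using hy i.castSucc
        · rwa [Fin.snoc_init_self]
    rw [this]
    exact isOpen_iUnion fun c => ih _

end Open

theorem isOpen_of_isSubbasic {U : Set (IndexedStructure L S)} (hU : IsSubbasic L S U) :
    IsOpen U := by
  have key : ∀ {n : ℕ} {φ : L.Formula (Fin n)}, BoundedFormula.IsAtomic φ → ∀ a : Fin n → S,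
      IsOpen (boundedSet φ a default) := fun hφ a =>
    isOpen_generateFrom_of_mem (.inr ⟨_, _, hφ, a, (fSet_eq_boundedSet _ _).symm⟩)
  cases hU with
  | eq a b =>
    convert key (.equal (Term.var (.inl 0)) (Term.var (.inl 1))) ![a, b]
    ext M
    constructor
    · rintro ⟨x, ha, hb⟩
      refine ⟨![x, x], default, ?_, fun i => i.elim0, ?_⟩
      · simpa [Fin.forall_fin_two] using ⟨ha, hb⟩
      · simp
    · rintro ⟨x, y, hx, -, h⟩
      have h' : x 0 = x 1 := by simpa using h
      exact ⟨x 0, hx 0, h' ▸ hx 1⟩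
  | @rel n R a =>
    convert key (.rel R fun i => Term.var (.inl i)) a
    ext M
    constructor
    · rintro ⟨x, ha, hb⟩
      exact ⟨x, default, ha, fun i => i.elim0, by simpa using hb⟩
    · rintro ⟨x, y, hx, -, h⟩
      exact ⟨x, hx, by simpa using h⟩
  | @func n f a b =>
    convert key (.equal (Term.func f fun i => Term.var (.inl i.castSucc))
      (Term.var (.inl (Fin.last n)))) (Fin.snoc a b)
    ext M
    constructor
    · rintro ⟨x, ha, hb⟩
      refine ⟨Fin.snoc x (Structure.funMap f x), default, fun i => ?_, fun i => i.elim0, ?_⟩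
      · induction i using Fin.lastCases with
        | last => simpa using hb
        | cast i => simpa using ha i
      · simp
    · rintro ⟨x, y, hx, -, h⟩
      refine ⟨Fin.init x, fun i => ?_, ?_⟩
      · simpa [Fin.init_def] using hx i.castSucc
      · have h' : Structure.funMap f (Fin.init x) = x (Fin.last n) := by
          simpa [Fin.init_def] using h
        simpa [h'] using hx (Fin.last n)

theorem logicalTopology_eq_generateFrom :
    logicalTopology L S = generateFrom {U | IsSubbasic L S U} := by
  refine le_antisymm (le_generateFrom fun U hU => isOpen_of_isSubbasic hU) ?_
  refine le_generateFrom ?_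
  let _ := generateFrom {U | IsSubbasic L S U}
  have hU : ∀ U, IsSubbasic L S U → IsOpen U := fun U h => isOpen_generateFrom_of_mem h
  rintro U (⟨a, rfl⟩ | ⟨n, φ, hφ, a, rfl⟩)
  · convert hU _ (.eq a a)
    ext M
    exact ⟨fun h => ⟨_, ⟨h, rfl⟩, ⟨h, rfl⟩⟩, fun ⟨_, h, _⟩ => h.1⟩
  · rw [fSet_eq_boundedSet]
    refine isOpen_boundedSet hU ?_ _ _
    cases hφ with
    | equal t₁ t₂ => exact .equal t₁ t₂
    | rel R ts => exact .rel R ts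

instance : T0Space (IndexedStructure L S) where
  t0 M N h := by
    have h' : ∀ {U}, IsSubbasic L S U → (M ∈ U ↔ N ∈ U) := fun hU =>
      h.mem_open_iff (isOpen_of_isSubbasic hU)
    clear h
    obtain ⟨A, r, s⟩ := M
    obtain ⟨A', r', s'⟩ := N
    obtain rfl : A = A' := by
      ext a
      have := h' (.eq a a)
      simpa [eqSet, IndexedStructure.Names] using this
    obtain rfl : r = r' := by
      ext a b
      have := h' (.eq a.1 b.1)
      simpa [eqSet, IndexedStructure.Names, IndexedStructure.cls, eq_comm, Quotient.eq] using this
    obtain rfl : s = s' := by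
      ext n f x
      · obtain ⟨a, ha⟩ := IndexedStructure.exists_names_pi (M := ⟨A, r, s⟩) x
        obtain ⟨b, hb⟩ := IndexedStructure.exists_names (M := ⟨A, r, s⟩) (s.funMap f x)
        obtain ⟨y, hy, hb'⟩ := (h' (.func f a b)).1 ⟨x, ha, hb⟩
        obtain rfl : x = y := IndexedStructure.Names.unique_pi (M := ⟨A, r, s⟩) ha hy
        exact IndexedStructure.Names.unique (M := ⟨A, r, s⟩) hb hb'
      · obtain ⟨a, ha⟩ := IndexedStructure.exists_names_pi (M := ⟨A, r, s⟩) x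
        have := h' (.rel f a)
        constructor
        · intro hx
          obtain ⟨y, hy, hb'⟩ := this.1 ⟨x, ha, hx⟩
          obtain rfl : x = y := IndexedStructure.Names.unique_pi (M := ⟨A, r, s⟩) ha hy
          exact hb'
        · intro hx
          obtain ⟨y, hy, hb'⟩ := this.2 ⟨x, ha, hx⟩
          obtain rfl : x = y := IndexedStructure.Names.unique_pi (M := ⟨A, r, s⟩) ha hy
          exact hb'
    rfl

section Irreducible

variable {X : Type*} [TopologicalSpace X] {Z : Set X}

theorem _root_.IsIrreducible.inter_iInter_nonempty (hZ : IsIrreducible Z) {ι : Type*} [Finite ι]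
    {U : ι → Set X} (hU : ∀ i, IsOpen (U i)) (h : ∀ i, (Z ∩ U i).Nonempty) :
    (Z ∩ ⋂ i, U i).Nonempty := by
  classical
  cases nonempty_fintype ι
  have := isIrreducible_iff_sInter.1 hZ (Finset.univ.image U) (by simpa using hU)
    (by simpa using h)
  simpa using this

/-- To compare an irreducible set with a point, it suffices to test subbasic open sets. -/
theorem _root_.IsIrreducible.mem_iff_inter_nonempty_of_generateFrom
    {g : Set (Set X)} (hg : ‹TopologicalSpace X› = generateFrom g) (hZ : IsIrreducible Z) {x : X}
    (hx : ∀ U ∈ g, (x ∈ U ↔ (Z ∩ U).Nonempty)) {U : Set X} (hU : IsOpen U) :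
    x ∈ U ↔ (Z ∩ U).Nonempty := by
  have hU' : GenerateOpen g U := by
    subst hg
    exact hU
  have hopen : ∀ V, GenerateOpen g V → IsOpen V := by
    subst hg
    exact fun V hV => hV
  clear hU
  induction hU' with
  | basic U h => exact hx U h
  | univ => simpa using hZ.nonempty
  | inter U V hU hV ihU ihV =>
    refine (and_congr ihU ihV).trans ⟨fun h => hZ.2 _ _ (hopen _ hU) (hopen _ hV) h.1 h.2,
      fun h => ⟨h.mono (by grind), h.mono (by grind)⟩⟩
  | sUnion K hK ih =>
    constructor
    · rintro ⟨V, hV, hxV⟩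
      obtain ⟨z, hz, hzV⟩ := (ih V hV).1 hxV
      exact ⟨z, hz, V, hV, hzV⟩
    · rintro ⟨z, hz, V, hV, hzV⟩
      exact ⟨V, hV, (ih V hV).2 ⟨z, hz, hzV⟩⟩

end Irreducible

section GenericStructure

variable {Z : Set (IndexedStructure L S)}

theorem mem_eqSet {a b : S} {M : IndexedStructure L S} {x y : M.carrier} (hx : M.Names a x)
    (hy : M.Names b y) : M ∈ eqSet L a b ↔ x = y := by
  constructor
  · rintro ⟨z, ha, hb⟩
    exact (hx.unique ha).trans (hb.unique hy)
  · rintro rfl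
    exact ⟨x, hx, hy⟩

/-- The equivalence of indices induced by an irreducible set of indexed structures. -/
def genericSetoid (hZ : IsIrreducible Z) : Setoid {a : S | (Z ∩ eqSet L a a).Nonempty} where
  r a b := (Z ∩ eqSet L a.1 b.1).Nonempty
  iseqv :=
    { refl := fun a => a.2
      symm := fun ⟨M, hM, x, ha, hb⟩ => ⟨M, hM, x, hb, ha⟩
      trans := by
        intro a b c hab hbc
        obtain ⟨M, hM, ⟨x, ha, hb⟩, ⟨y, hb', hc⟩⟩ := hZ.2 _ _ (isOpen_of_isSubbasic (.eq _ _))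
          (isOpen_of_isSubbasic (.eq _ _)) hab hbc
        obtain rfl := hb.unique hb'
        exact ⟨M, hM, x, ha, hc⟩ }

theorem exists_inter_funSet_nonempty (hZ : IsIrreducible Z) {n : ℕ} (f : L.Functions n)
    (a : Fin n → {a : S | (Z ∩ eqSet L a a).Nonempty}) :
    ∃ b : {a : S | (Z ∩ eqSet L a a).Nonempty},
      (Z ∩ funSet f (fun i => (a i : S)) b).Nonempty := by
  obtain ⟨M, hM, h⟩ := hZ.inter_iInter_nonempty
    (fun i => isOpen_of_isSubbasic (.eq (a i : S) (a i : S))) fun i => (a i).2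
  choose x hx _ using mem_iInter.1 h
  obtain ⟨b, hb⟩ := M.exists_names (Structure.funMap f x)
  exact ⟨⟨b, M, hM, _, hb, hb⟩, M, hM, x, hx, hb⟩

/-- The generic point of an irreducible set of indexed structures. -/
noncomputable def genericStructure (hZ : IsIrreducible Z) : IndexedStructure L S where
  A := {a : S | (Z ∩ eqSet L a a).Nonempty}
  r := genericSetoid hZ
  str :=
    { funMap := fun f x => Quotient.mk _
        (Classical.choose (exists_inter_funSet_nonempty hZ f fun i => (x i).out))
      RelMap := fun {n} R x => ∃ a : Fin n → {a : S | (Z ∩ eqSet L a a).Nonempty},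
        (∀ i, Quotient.mk (genericSetoid hZ) (a i) = x i) ∧
          (Z ∩ relSet R fun i => (a i : S)).Nonempty }

theorem genericStructure_mem_iff_of_isSubbasic (hZ : IsIrreducible Z)
    {U : Set (IndexedStructure L S)} (hU : IsSubbasic L S U) :
    genericStructure hZ ∈ U ↔ (Z ∩ U).Nonempty := by
  have heq : ∀ {a b : {a : S | (Z ∩ eqSet L a a).Nonempty}},
      Quotient.mk (genericSetoid hZ) a = Quotient.mk _ b ↔ (Z ∩ eqSet L a.1 b.1).Nonempty :=
    Quotient.eq
  cases hU with
  | eq a b =>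
    constructor
    · rintro ⟨x, ⟨ha, rfl⟩, ⟨hb, h⟩⟩
      exact heq.1 h.symm
    · intro h
      have ha : (Z ∩ eqSet L a a).Nonempty := let ⟨M, hM, x, ha, _⟩ := h; ⟨M, hM, x, ha, ha⟩
      have hb : (Z ∩ eqSet L b b).Nonempty := let ⟨M, hM, x, _, hb⟩ := h; ⟨M, hM, x, hb, hb⟩
      exact ⟨(genericStructure hZ).cls a ha, ⟨ha, rfl⟩, hb,
        (heq (a := ⟨a, ha⟩) (b := ⟨b, hb⟩).2 h).symm⟩
  | @rel n R a =>
    constructor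
    · rintro ⟨x, hx, a', ha', h⟩
      have h' : ∀ i, (Z ∩ eqSet L (a' i : S) (a i)).Nonempty := fun i => by
        obtain ⟨hi, e⟩ := hx i
        exact heq.1 ((ha' i).trans e.symm)
      obtain ⟨M, hM, ⟨y, hy, hR⟩, h⟩ := hZ.2 _ _ (isOpen_of_isSubbasic (.rel _ _))
        (isOpen_iInter_of_finite fun i => isOpen_of_isSubbasic (.eq (a' i : S) (a i))) h
        (hZ.inter_iInter_nonempty (fun i => isOpen_of_isSubbasic (.eq _ _)) h')
      choose z hz hz' using mem_iInter.1 h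
      obtain rfl := IndexedStructure.Names.unique_pi hy hz
      exact ⟨M, hM, y, hz', hR⟩
    · intro h
      have ha : ∀ i, (Z ∩ eqSet L (a i) (a i)).Nonempty := fun i =>
        let ⟨M, hM, x, hx, _⟩ := h; ⟨M, hM, x i, hx i, hx i⟩
      exact ⟨fun i => Quotient.mk _ ⟨a i, ha i⟩, fun i => ⟨ha i, rfl⟩,
        fun i => ⟨a i, ha i⟩, fun i => rfl, h⟩
  | @func n f a b =>
    have key : ∀ ha : ∀ i, (Z ∩ eqSet L (a i) (a i)).Nonempty,
        ∃ (c : Fin n → S) (d : {a : S | (Z ∩ eqSet L a a).Nonempty}),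
          Structure.funMap f (fun i => (genericStructure hZ).cls (a i) (ha i)) =
            Quotient.mk (genericSetoid hZ) d ∧
          (Z ∩ (funSet f c d ∩ ⋂ i, eqSet L (c i) (a i))).Nonempty := by
      intro ha
      refine ⟨_, _, rfl, hZ.2 _ _ (isOpen_of_isSubbasic (.func _ _ _))
        (isOpen_iInter_of_finite fun i => isOpen_of_isSubbasic (.eq _ _))
        (Classical.choose_spec (exists_inter_funSet_nonempty hZ f fun i =>
          Quotient.out (s := genericSetoid hZ) (Quotient.mk _ ⟨a i, ha i⟩)))
        (hZ.inter_iInter_nonempty (fun i => isOpen_of_isSubbasic (.eq _ _)) fun i => ?_)⟩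
      exact Quotient.mk_out (s := genericSetoid hZ) ⟨a i, ha i⟩
    have hopen : ∀ (c : Fin n → S) d, IsOpen (funSet f c d ∩ ⋂ i, eqSet L (c i) (a i)) :=
      fun c d => (isOpen_of_isSubbasic (.func _ _ _)).inter
        (isOpen_iInter_of_finite fun i => isOpen_of_isSubbasic (.eq _ _))
    constructor
    · rintro ⟨x, hx, hb, e⟩
      have ha : ∀ i, (Z ∩ eqSet L (a i) (a i)).Nonempty := fun i => (hx i).1
      obtain ⟨c, d, hd, h⟩ := key ha
      obtain rfl : x = fun i => (genericStructure hZ).cls (a i) (ha i) :=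
        IndexedStructure.Names.unique_pi hx fun i => ⟨ha i, rfl⟩
      obtain ⟨M, hM, ⟨⟨y, hy, hyd⟩, h⟩, w, hw, hw'⟩ := hZ.2 _ _ (hopen c d)
        (isOpen_of_isSubbasic (.eq (d : S) b)) h (heq.1 (hd.symm.trans e.symm))
      choose z hz hz' using mem_iInter.1 h
      obtain rfl := IndexedStructure.Names.unique_pi hy hz
      exact ⟨M, hM, y, hz', hyd.unique hw ▸ hw'⟩
    · intro h
      have ha : ∀ i, (Z ∩ eqSet L (a i) (a i)).Nonempty := fun i =>
        let ⟨M, hM, x, hx, _⟩ := h; ⟨M, hM, x i, hx i, hx i⟩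
      have hb : (Z ∩ eqSet L b b).Nonempty :=
        let ⟨M, hM, x, _, hx⟩ := h; ⟨M, hM, _, hx, hx⟩
      obtain ⟨c, d, hd, h'⟩ := key ha
      refine ⟨fun i => (genericStructure hZ).cls (a i) (ha i), fun i => ⟨ha i, rfl⟩, hb, ?_⟩
      rw [hd]
      refine heq.2 ?_
      obtain ⟨M, hM, ⟨w, hw, hwb⟩, ⟨y, hy, hyd⟩, h⟩ := hZ.2 _ _
        (isOpen_of_isSubbasic (.func f a b)) (hopen c d) h h'
      choose z hz hz' using mem_iInter.1 h
      obtain rfl := IndexedStructure.Names.unique_pi hy hz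
      obtain rfl := IndexedStructure.Names.unique_pi hw hz'
      exact ⟨M, hM, _, hwb, hyd⟩

theorem genericStructure_mem_iff (hZ : IsIrreducible Z) {U : Set (IndexedStructure L S)}
    (hU : IsOpen U) : genericStructure hZ ∈ U ↔ (Z ∩ U).Nonempty :=
  hZ.mem_iff_inter_nonempty_of_generateFrom logicalTopology_eq_generateFrom
    (fun _ h => genericStructure_mem_iff_of_isSubbasic hZ h) hU

theorem genericStructure_models {T : Set L.Sentence} (hT : ∀ σ ∈ T, IsCoherentSequent σ)
    (hZ : IsIrreducible Z) (hZT : ∀ M ∈ Z, M.models T) : (genericStructure hZ).models T := by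
  intro σ hσ
  obtain ⟨n, φ, ψ, hφ, hψ, rfl⟩ := hT σ hσ
  refine BoundedFormula.realize_alls.2 fun y hy => ?_
  obtain ⟨b, hb⟩ := (genericStructure hZ).exists_names_pi y
  have hopen : ∀ {χ : L.BoundedFormula Empty n}, IsCoherent χ →
      IsOpen (boundedSet χ (default : Empty → S) b) := fun h =>
    isOpen_boundedSet (fun U => isOpen_of_isSubbasic) h _ _
  obtain ⟨M, hM, x', y', hx', hy', h⟩ := (genericStructure_mem_iff hZ (hopen hφ)).1
    ⟨default, y, fun i => i.elim, hb, hy⟩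
  have hM' : M ∈ boundedSet ψ default b := by
    refine ⟨x', y', hx', hy', ?_⟩
    have := BoundedFormula.realize_alls.1 (hZT M hM _ hσ) y'
    obtain rfl : x' = default := Subsingleton.elim _ _
    exact this h
  obtain ⟨x, z, -, hz, h'⟩ := (genericStructure_mem_iff hZ (hopen hψ)).2 ⟨M, hM, hM'⟩
  obtain rfl := IndexedStructure.Names.unique_pi hb hz
  obtain rfl : x = default := Subsingleton.elim _ _
  exact h'

end GenericStructure

section Iso

theorem continuous_dom : Continuous (IndexedIso.dom : IndexedIso L S → _) :=
  continuous_iff_le_induced.2 (inf_le_left.trans inf_le_left)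

theorem continuous_cod : Continuous (IndexedIso.cod : IndexedIso L S → _) :=
  continuous_iff_le_induced.2 (inf_le_left.trans inf_le_right)

theorem isOpen_mapSet (a b : S) : IsOpen (mapSet a b : Set (IndexedIso L S)) :=
  (inf_le_right : isoTopology L S ≤ _) _ (isOpen_generateFrom_of_mem ⟨a, b, rfl⟩)

theorem mem_mapSet_iff {F : IndexedIso L S} {a b : S} {x : F.dom.carrier} {y : F.cod.carrier}
    (ha : F.dom.Names a x) (hb : F.cod.Names b y) : F ∈ mapSet a b ↔ F.map x = y := by
  obtain ⟨ha, rfl⟩ := ha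
  obtain ⟨hb, rfl⟩ := hb
  exact ⟨fun h => h.2.2, fun h => ⟨ha, hb, h⟩⟩

theorem exists_of_mem_mapSet {F : IndexedIso L S} {a b : S} (h : F ∈ mapSet a b) :
    ∃ x, F.dom.Names a x ∧ F.cod.Names b (F.map x) :=
  ⟨_, ⟨h.1, rfl⟩, h.2.1, h.2.2.symm⟩

variable (L S) in
/-- The defining generators of the logical topology on the space of isomorphisms. -/
inductive IsIsoSubbasic : Set (IndexedIso L S) → Prop
  | dom {U : Set (IndexedStructure L S)} (hU : IsOpen U) :
      IsIsoSubbasic (IndexedIso.dom ⁻¹' U)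
  | cod {U : Set (IndexedStructure L S)} (hU : IsOpen U) :
      IsIsoSubbasic (IndexedIso.cod ⁻¹' U)
  | map (a b : S) : IsIsoSubbasic (mapSet a b)

theorem isoTopology_eq_generateFrom :
    isoTopology L S = generateFrom {U | IsIsoSubbasic L S U} := by
  refine le_antisymm (le_generateFrom ?_) (le_inf (le_inf ?_ ?_) (le_generateFrom ?_))
  · rintro _ (hU | hU | ⟨a, b⟩)
    exacts [hU.preimage continuous_dom, hU.preimage continuous_cod, isOpen_mapSet a b]
  · rintro _ ⟨U, hU, rfl⟩
    exact isOpen_generateFrom_of_mem (.dom hU)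
  · rintro _ ⟨U, hU, rfl⟩
    exact isOpen_generateFrom_of_mem (.cod hU)
  · rintro _ ⟨a, b, rfl⟩
    exact isOpen_generateFrom_of_mem (.map a b)

instance : T0Space (IndexedIso L S) where
  t0 F G h := by
    have hd : F.dom = G.dom := (h.map continuous_dom).eq
    have hc : F.cod = G.cod := (h.map continuous_cod).eq
    have hm : ∀ a b, F ∈ mapSet a b → G ∈ mapSet a b := fun a b =>
      (h.mem_open_iff (isOpen_mapSet a b)).1
    clear h
    obtain ⟨M, N, f⟩ := F
    obtain ⟨M', N', g⟩ := G
    dsimp only at hd hc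
    subst hd hc
    congr
    ext x
    obtain ⟨a, ha⟩ := M.exists_names x
    obtain ⟨b, hb⟩ := N.exists_names (f x)
    exact ((mem_mapSet_iff (F := ⟨M, N, g⟩) ha hb).1
      (hm a b ((mem_mapSet_iff (F := ⟨M, N, f⟩) ha hb).2 rfl))).symm

variable {K : Set (IndexedIso L S)}

/-- An irreducible set of isomorphisms has a point, lying over the generic points of its sets
of domains and codomains, that belongs to exactly the open sets meeting it. -/
theorem exists_generic_indexedIso (hK : IsIrreducible K) :
    ∃ G : IndexedIso L S,
      G.dom = genericStructure (hK.image _ continuous_dom.continuousOn) ∧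
      G.cod = genericStructure (hK.image _ continuous_cod.continuousOn) ∧
      ∀ U, IsOpen U → (G ∈ U ↔ (K ∩ U).Nonempty) := by
  set M := genericStructure (hK.image _ continuous_dom.continuousOn) with hMdef
  set N := genericStructure (hK.image _ continuous_cod.continuousOn) with hNdef
  have hM : ∀ {U}, IsOpen U → (M ∈ U ↔ (K ∩ IndexedIso.dom ⁻¹' U).Nonempty) := fun hU => by
    rw [hMdef, genericStructure_mem_iff _ hU, image_inter_nonempty_iff]
  have hN : ∀ {U}, IsOpen U → (N ∈ U ↔ (K ∩ IndexedIso.cod ⁻¹' U).Nonempty) := fun hU => by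
    rw [hNdef, genericStructure_mem_iff _ hU, image_inter_nonempty_iff]
  clear_value M N
  have hMs : ∀ {U}, IsSubbasic L S U → (M ∈ U ↔ (K ∩ IndexedIso.dom ⁻¹' U).Nonempty) :=
    fun hU => hM (isOpen_of_isSubbasic hU)
  have hNs : ∀ {U}, IsSubbasic L S U → (N ∈ U ↔ (K ∩ IndexedIso.cod ⁻¹' U).Nonempty) :=
    fun hU => hN (isOpen_of_isSubbasic hU)
  have hod : ∀ {U}, IsSubbasic L S U → IsOpen (IndexedIso.dom ⁻¹' U) := fun hU =>
    (isOpen_of_isSubbasic hU).preimage continuous_dom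
  have hoc : ∀ {U}, IsSubbasic L S U → IsOpen (IndexedIso.cod ⁻¹' U) := fun hU =>
    (isOpen_of_isSubbasic hU).preimage continuous_cod
  have total : ∀ x : M.carrier, ∃ y : N.carrier, ∃ a b, M.Names a x ∧ N.Names b y ∧
      (K ∩ mapSet a b).Nonempty := by
    intro x
    obtain ⟨a, ha⟩ := M.exists_names x
    obtain ⟨F, hF, z, hz, -⟩ := (hMs (.eq a a)).1 ⟨x, ha, ha⟩
    obtain ⟨b, hb⟩ := F.cod.exists_names (F.map z)
    obtain ⟨y, hy, -⟩ := (hNs (.eq b b)).2 ⟨F, hF, _, hb, hb⟩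
    exact ⟨y, a, b, ha, hy, F, hF, (mem_mapSet_iff hz hb).2 rfl⟩
  have surj : ∀ y : N.carrier, ∃ x : M.carrier, ∃ a b, M.Names a x ∧ N.Names b y ∧
      (K ∩ mapSet a b).Nonempty := by
    intro y
    obtain ⟨b, hb⟩ := N.exists_names y
    obtain ⟨F, hF, z, hz, -⟩ := (hNs (.eq b b)).1 ⟨y, hb, hb⟩
    obtain ⟨w, rfl⟩ : ∃ w, F.map w = z := F.iso.toEquiv.surjective z
    obtain ⟨a, ha⟩ := F.dom.exists_names w
    obtain ⟨x, hx, -⟩ := (hMs (.eq a a)).2 ⟨F, hF, _, ha, ha⟩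
    exact ⟨x, a, b, hx, hb, F, hF, (mem_mapSet_iff ha hz).2 rfl⟩
  have unique : ∀ {a a' b b' : S} {x x' : M.carrier} {y y' : N.carrier}, M.Names a x →
      M.Names a' x' → N.Names b y → N.Names b' y' → (K ∩ mapSet a b).Nonempty →
      (K ∩ mapSet a' b').Nonempty → (x = x' ↔ y = y') := by
    intro a a' b b' x x' y y' ha ha' hb hb' h h'
    rw [← mem_eqSet ha ha', ← mem_eqSet hb hb', hMs (.eq _ _), hNs (.eq _ _)]
    have h'' := hK.2 _ _ (isOpen_mapSet _ _) (isOpen_mapSet _ _) h h'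
    constructor <;> intro he
    · obtain ⟨F, hF, ⟨h₁, h₂⟩, h₃⟩ := hK.2 _ _ ((isOpen_mapSet _ _).inter (isOpen_mapSet _ _))
        (hod (.eq _ _)) h'' he
      obtain ⟨z, hz, hz'⟩ := exists_of_mem_mapSet h₁
      obtain ⟨w, hw, hw'⟩ := exists_of_mem_mapSet h₂
      obtain rfl := (mem_eqSet hz hw).1 h₃
      exact ⟨F, hF, _, hz', hw'⟩
    · obtain ⟨F, hF, ⟨h₁, h₂⟩, h₃⟩ := hK.2 _ _ ((isOpen_mapSet _ _).inter (isOpen_mapSet _ _))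
        (hoc (.eq _ _)) h'' he
      obtain ⟨z, hz, hz'⟩ := exists_of_mem_mapSet h₁
      obtain ⟨w, hw, hw'⟩ := exists_of_mem_mapSet h₂
      obtain rfl : z = w := F.iso.toEquiv.injective ((mem_eqSet hz' hw').1 h₃)
      exact ⟨F, hF, _, hz, hw⟩
  choose g ga gb hga hgb hg using total
  have hbij : Function.Bijective g := by
    refine ⟨fun x x' h => (unique (hga x) (hga x') (hgb x) (hgb x') (hg x) (hg x')).2 h,
      fun y => ?_⟩
    obtain ⟨x, a, b, ha, hb, h⟩ := surj y
    exact ⟨x, (unique (hga x) ha (hgb x) hb (hg x) h).1 rfl⟩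
  have inter_map : ∀ {n : ℕ} (x : Fin n → M.carrier) {U : Set (IndexedIso L S)}, IsOpen U →
      (K ∩ U).Nonempty → ∃ F ∈ K, F ∈ U ∧ ∃ z : Fin n → F.dom.carrier,
        (∀ i, F.dom.Names (ga (x i)) (z i)) ∧ ∀ i, F.cod.Names (gb (x i)) (F.map (z i)) := by
    intro n x U hU h
    obtain ⟨F, hF, hFU, h⟩ := hK.2 _ _ hU
      (isOpen_iInter_of_finite fun i => isOpen_mapSet (ga (x i)) (gb (x i))) h
      (hK.inter_iInter_nonempty (fun i => isOpen_mapSet _ _) fun i => hg (x i))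
    choose z hz hz' using fun i => exists_of_mem_mapSet (mem_iInter.1 h i)
    exact ⟨F, hF, hFU, z, hz, hz'⟩
  let G : IndexedIso L S := ⟨M, N,
    { toEquiv := Equiv.ofBijective g hbij
      map_fun' := by
        intro n f x
        have hU := (hMs (.func f (fun i => ga (x i)) (ga (Structure.funMap f x)))).1
          ⟨x, fun i => hga _, hga _⟩
        obtain ⟨F, hF, ⟨h₁, h₂⟩, z, hz, hz'⟩ := inter_map x
          ((hod (.func _ _ _)).inter (isOpen_mapSet _ _))
          (hK.2 _ _ (hod (.func _ _ _)) (isOpen_mapSet _ _) hU (hg (Structure.funMap f x)))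
        obtain ⟨z', hz₁, hz₂⟩ := h₁
        obtain rfl := IndexedStructure.Names.unique_pi hz hz₁
        obtain ⟨y, hy, hy'⟩ := (hNs (.func f (fun i => gb (x i))
          (gb (Structure.funMap f x)))).2 ⟨F, hF, _, hz', by
            obtain ⟨w, hw, hw'⟩ := exists_of_mem_mapSet h₂
            obtain rfl := hz₂.unique hw
            have e : F.map (Structure.funMap f z) = Structure.funMap f fun i => F.map (z i) :=
              F.iso.map_fun' f z
            rwa [e] at hw'⟩
        obtain rfl := IndexedStructure.Names.unique_pi hy fun i => hgb (x i)
        exact (hgb _).unique hy'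
      map_rel' := by
        intro n R x
        have e : ∀ (F : IndexedIso L S) (z : Fin n → F.dom.carrier),
            Structure.RelMap R (fun i => F.map (z i)) ↔ Structure.RelMap R z :=
          fun F z => F.iso.map_rel' R z
        constructor <;> intro h
        · obtain ⟨F, hF, ⟨w, hw, hR⟩, z, hz, hz'⟩ := inter_map x (hoc (.rel _ _))
            ((hNs (.rel R fun i => gb (x i))).1 ⟨_, fun i => hgb _, h⟩)
          obtain rfl := IndexedStructure.Names.unique_pi hz' hw
          obtain ⟨y, hy, hy'⟩ := (hMs (.rel R fun i => ga (x i))).2 ⟨F, hF, z, hz, (e F z).1 hR⟩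
          obtain rfl := IndexedStructure.Names.unique_pi hy fun i => hga (x i)
          exact hy'
        · obtain ⟨F, hF, ⟨w, hw, hR⟩, z, hz, hz'⟩ := inter_map x (hod (.rel _ _))
            ((hMs (.rel R fun i => ga (x i))).1 ⟨_, fun i => hga _, h⟩)
          obtain rfl := IndexedStructure.Names.unique_pi hz hw
          obtain ⟨y, hy, hy'⟩ := (hNs (.rel R fun i => gb (x i))).2
            ⟨F, hF, _, hz', (e F z).2 hR⟩
          obtain rfl := IndexedStructure.Names.unique_pi hy fun i => hgb (x i)
          exact hy' }⟩
  have hGmap : ∀ x, G.map x = g x := fun x => rfl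
  refine ⟨G, rfl, rfl, fun U hU =>
    hK.mem_iff_inter_nonempty_of_generateFrom isoTopology_eq_generateFrom ?_ hU⟩
  rintro _ (hU | hU | ⟨a, b⟩)
  · exact hM hU
  · exact hN hU
  · constructor
    · intro h
      obtain ⟨x, hx, hy⟩ := exists_of_mem_mapSet h
      rw [hGmap] at hy
      obtain ⟨F, hF, ⟨h₁, h₂⟩, h₃⟩ := hK.2 _ _ ((hod (.eq _ _)).inter (hoc (.eq _ _)))
        (isOpen_mapSet _ _)
        (hK.2 _ _ (hod (.eq _ _)) (hoc (.eq _ _)) ((hMs (.eq (ga x) a)).1 ⟨x, hga x, hx⟩)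
          ((hNs (.eq (gb x) b)).1 ⟨_, hgb x, hy⟩)) (hg x)
      obtain ⟨z, hz, hz'⟩ := exists_of_mem_mapSet h₃
      obtain ⟨w, hw, hw'⟩ := h₁
      obtain ⟨v, hv, hv'⟩ := h₂
      refine ⟨F, hF, (mem_mapSet_iff hw' hv').2 ?_⟩
      rw [hw.unique hz, hv.unique hz']
    · intro h
      obtain ⟨F, hF, hab⟩ := id h
      obtain ⟨z, hz, hz'⟩ := exists_of_mem_mapSet hab
      obtain ⟨x, hx, -⟩ := (hMs (.eq a a)).2 ⟨F, hF, _, hz, hz⟩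
      obtain ⟨y, hy, -⟩ := (hNs (.eq b b)).2 ⟨F, hF, _, hz', hz'⟩
      exact (mem_mapSet_iff (F := G) hx hy).2
        ((unique (hga x) hx (hgb x) hy (hg x) h).1 rfl)

end Iso

theorem stmt6 (T : Set L.Sentence) (hT : ∀ σ ∈ T, IsCoherentSequent σ) :
    QuasiSober (IsoT L S T) ∧ T0Space (IsoT L S T) := by
  refine ⟨⟨fun {K} hK hKc => ?_⟩, inferInstance⟩
  have hK' : IsIrreducible (Subtype.val '' K : Set (IndexedIso L S)) :=
    hK.image _ continuous_subtype_val.continuousOn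
  obtain ⟨G, hd, hc, hG⟩ := exists_generic_indexedIso hK'
  have hGT : G.dom.models T ∧ G.cod.models T := by
    rw [hd, hc]
    refine ⟨genericStructure_models hT _ ?_, genericStructure_models hT _ ?_⟩
    · rintro _ ⟨_, ⟨F, -, rfl⟩, rfl⟩
      exact F.2.1
    · rintro _ ⟨_, ⟨F, -, rfl⟩, rfl⟩
      exact F.2.2
  have hmem : ∀ U : Set (IsoT L S T), IsOpen U →
      ((⟨G, hGT⟩ : IsoT L S T) ∈ U ↔ (K ∩ U).Nonempty) := by
    rintro _ ⟨U, hU, rfl⟩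
    rw [mem_preimage, hG U hU, image_inter_nonempty_iff]
  refine ⟨⟨G, hGT⟩, isGenericPoint_iff_specializes.2 fun F => ?_⟩
  rw [specializes_iff_forall_open]
  constructor
  · intro h
    by_contra hF
    obtain ⟨F', h₁, h₂⟩ := (hmem _ hKc.isOpen_compl).1 (h _ hKc.isOpen_compl hF)
    exact h₂ h₁
  · exact fun hF U hU hFU => (hmem U hU).2 ⟨F, hF, hFU⟩

end SemGpd
end

section
/- Let T be a set of L-sentences and φ an L-formula with free variables among x₁,…,xₙ. The sets ⟨ψ,b⟩_{D_φ} := {(M,m) ∈ D_φ : every bⱼ is indexed in M and ψ is satisfied in M under xᵢ ↦ mᵢ, yⱼ ↦ [bⱼ]}, where ψ ranges over Horn formulas with free variables among x₁,…,xₙ,y₁,…,y_m and b over m-tuples of elements of S, form a basis for the logical topology on D_φ. -/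
open FirstOrder Language Set Topology TopologicalSpace Cardinal

universe u v w

namespace SemGpd

variable (L : FirstOrder.Language.{u, v}) (S : Type w)

variable {L S}

variable (L S)

variable {L S}

variable (L S)

variable {L S}

variable (L S)

variable {L S}

variable (L S)

variable {L S}

variable (L S)

variable {L S}

variable {L : FirstOrder.Language.{u, v}} {S : Type w}

namespace IndexedStructure

theorem sat_relabel (M : IndexedStructure L S) {α β : Type*} (ψ : L.Formula α) (g : α → β)
    (v : β → M.carrier) : M.Sat (ψ.relabel g) v ↔ M.Sat ψ (v ∘ g) :=
  let := M.str
  Formula.realize_relabel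

theorem sat_inf (M : IndexedStructure L S) {α : Type*} (ψ χ : L.Formula α)
    (v : α → M.carrier) : M.Sat (ψ ⊓ χ) v ↔ M.Sat ψ v ∧ M.Sat χ v :=
  let := M.str
  BoundedFormula.realize_inf

theorem sat_top (M : IndexedStructure L S) {α : Type*} (v : α → M.carrier) :
    M.Sat (⊤ : L.Formula α) v :=
  let := M.str
  BoundedFormula.realize_top.2 trivial

theorem sat_equal_var (M : IndexedStructure L S) {α : Type*} (i j : α) (v : α → M.carrier) :
    M.Sat (Term.equal (L := L) (Term.var i) (Term.var j)) v ↔ v i = v j :=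
  let := M.str
  Formula.realize_equal

end IndexedStructure

theorem IsHorn.of_isAtomic {α : Type*} {k : ℕ} {ψ : L.BoundedFormula α k} (h : ψ.IsAtomic) :
    IsHorn ψ := by
  cases h with
  | equal t₁ t₂ => exact .equal t₁ t₂
  | rel R ts => exact .rel R ts

theorem IsHorn.relabel {α β : Type*} {k l : ℕ} {ψ : L.BoundedFormula α k} (h : IsHorn ψ)
    (g : α → β ⊕ Fin l) : IsHorn (ψ.relabel g) := by
  induction h with
  | top => exact .top
  | equal t₁ t₂ => exact .equal _ _
  | rel R ts => exact .rel R _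
  | inf _ _ ih₁ ih₂ => exact .inf ih₁ ih₂

variable (L) in
theorem isOpen_membSet (a : S) : IsOpen (membSet L S a) :=
  isOpen_generateFrom_of_mem (.inl ⟨a, rfl⟩)

/-- The analogue of `fSet` for a formula whose free variables come from an arbitrary type. -/
def satSet {β : Type*} {k : ℕ} (ψ : L.BoundedFormula β k) (hk : k = 0) (c : β → S) :
    Set (IndexedStructure L S) :=
  {M | ∃ h : ∀ i, c i ∈ M.A, M.Sat (hk ▸ ψ : L.BoundedFormula β 0) fun i => M.cls (c i) (h i)}

theorem isOpen_satSet_of_isAtomic {β : Type*} [Finite β] {ψ : L.Formula β}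
    (hψ : BoundedFormula.IsAtomic ψ) (c : β → S) : IsOpen (satSet ψ rfl c) := by
  obtain ⟨k, ⟨e⟩⟩ := Finite.exists_equiv_fin β
  refine isOpen_generateFrom_of_mem
    (.inr ⟨k, ψ.relabel e, hψ.relabel _, c ∘ e.symm, ?_⟩)
  ext M
  constructor
  · rintro ⟨h, hs⟩
    refine ⟨fun i => h _, (M.sat_relabel _ _ _).2 ?_⟩
    convert hs using 1
    funext i
    simp only [Function.comp_apply]
    congr 1
    simp
  · rintro ⟨h, hs⟩
    have h' : ∀ i, c i ∈ M.A := fun i => by simpa using h (e i)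
    refine ⟨h', ?_⟩
    convert (M.sat_relabel _ _ _).1 hs using 1
    funext i
    simp only [Function.comp_apply]
    congr 1
    simp

theorem IsHorn.isOpen_satSet {β : Type*} [Finite β] {k : ℕ} {ψ : L.BoundedFormula β k}
    (hψ : IsHorn ψ) (hk : k = 0) (c : β → S) : IsOpen (satSet ψ hk c) := by
  induction hψ with
  | top =>
    subst hk
    convert isOpen_iInter_of_finite fun i => isOpen_membSet L (c i)
    ext M
    simp only [mem_iInter]
    exact ⟨fun h => h.1, fun h => ⟨h, M.sat_top _⟩⟩
  | equal t₁ t₂ =>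
    subst hk
    exact isOpen_satSet_of_isAtomic (.equal t₁ t₂) c
  | rel R ts =>
    subst hk
    exact isOpen_satSet_of_isAtomic (.rel R ts) c
  | inf _ _ ih₁ ih₂ =>
    subst hk
    convert ih₁.inter ih₂
    ext M
    constructor
    · rintro ⟨h, hs⟩
      exact ⟨⟨h, ((M.sat_inf _ _ _).1 hs).1⟩, ⟨h, ((M.sat_inf _ _ _).1 hs).2⟩⟩
    · rintro ⟨⟨h, hs₁⟩, ⟨_, hs₂⟩⟩
      exact ⟨h, (M.sat_inf _ _ _).2 ⟨hs₁, hs₂⟩⟩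

theorem IndexedStructure.exists_cls (M : IndexedStructure L S) (x : M.carrier) :
    ∃ (a : S) (h : a ∈ M.A), M.cls a h = x := by
  obtain ⟨⟨a, h⟩, rfl⟩ := Quotient.exists_rep x
  exact ⟨a, h, rfl⟩

section DSet

variable {T : Set L.Sentence} {n : ℕ} {φ : L.Formula (Fin n)}

theorem continuous_pi : Continuous (DSet.pi : DSet L S T φ → ModelsT L S T) :=
  continuous_iff_le_induced.2 inf_le_left

variable (T φ) in
theorem isOpen_secImage (a : Fin n → S) : IsOpen (secImage L S T φ a) :=
  (inf_le_right : dTopology L S T φ ≤ _) _ (isOpen_generateFrom_of_mem ⟨a, rfl⟩)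

theorem IsHorn.isOpen_dBasic {m : ℕ} {ψ : L.Formula (Fin n ⊕ Fin m)} (hψ : IsHorn ψ)
    (b : Fin m → S) : IsOpen (dBasic L S T φ ψ b) := by
  refine isOpen_iff_forall_mem_open.2 ?_
  rintro d ⟨hb, hs⟩
  choose a ha hd using fun i => d.str.exists_cls (d.tup i)
  refine ⟨secImage L S T φ a ∩ DSet.pi ⁻¹' (Subtype.val ⁻¹' satSet ψ rfl (Sum.elim a b)),
    ?_, ?_, ?_⟩
  · rintro d' ⟨⟨ha', hd'⟩, h, hs'⟩
    refine ⟨fun j => h (.inr j), ?_⟩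
    change d'.str.Sat ψ fun i => d'.str.cls (Sum.elim a b i) (h i) at hs'
    convert hs' using 1
    funext i
    rcases i with i | j
    · exact congrFun hd' i
    · rfl
  · exact (isOpen_secImage T φ a).inter
      (((hψ.isOpen_satSet rfl _).preimage continuous_subtype_val).preimage continuous_pi)
  · refine ⟨⟨ha, funext fun i => (hd i).symm⟩, Sum.rec ha hb, ?_⟩
    change d.str.Sat ψ fun i => d.str.cls (Sum.elim a b i) (Sum.rec ha hb i)
    convert hs using 1
    funext i
    rcases i with i | j
    · exact hd i
    · rfl

variable (T φ) in
theorem dBasic_inter {m k : ℕ} (ψ : L.Formula (Fin n ⊕ Fin m)) (χ : L.Formula (Fin n ⊕ Fin k))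
    (b : Fin m → S) (c : Fin k → S) :
    dBasic L S T φ ψ b ∩ dBasic L S T φ χ c =
      dBasic L S T φ (ψ.relabel (Sum.map id (Fin.castAdd k)) ⊓
        χ.relabel (Sum.map id (Fin.natAdd m))) (Fin.append b c) := by
  have key : ∀ (d : DSet L S T φ) (h : ∀ j, Fin.append b c j ∈ d.str.A)
      (hb : ∀ j, b j ∈ d.str.A) (hc : ∀ j, c j ∈ d.str.A),
      (Sum.elim d.tup fun j => d.str.cls _ (h j)) ∘ Sum.map id (Fin.castAdd k) =
        (Sum.elim d.tup fun j => d.str.cls _ (hb j)) ∧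
      (Sum.elim d.tup fun j => d.str.cls _ (h j)) ∘ Sum.map id (Fin.natAdd m) =
        (Sum.elim d.tup fun j => d.str.cls _ (hc j)) := by
    intro d h hb hc
    constructor <;> funext i <;> rcases i with i | j <;> simp
  ext d
  constructor
  · rintro ⟨⟨hb, hs⟩, ⟨hc, hs'⟩⟩
    have h : ∀ j, Fin.append b c j ∈ d.str.A := fun j =>
      Fin.addCases (fun i => by simpa using hb i) (fun i => by simpa using hc i) j
    refine ⟨h, (d.str.sat_inf _ _ _).2 ⟨(d.str.sat_relabel _ _ _).2 ?_,
      (d.str.sat_relabel _ _ _).2 ?_⟩⟩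
    · rwa [(key d h hb hc).1]
    · rwa [(key d h hb hc).2]
  · rintro ⟨h, hs⟩
    have hb : ∀ j, b j ∈ d.str.A := fun j => by simpa using h (Fin.castAdd k j)
    have hc : ∀ j, c j ∈ d.str.A := fun j => by simpa using h (Fin.natAdd m j)
    obtain ⟨hs₁, hs₂⟩ := (d.str.sat_inf _ _ _).1 hs
    rw [d.str.sat_relabel, (key d h hb hc).1] at hs₁
    rw [d.str.sat_relabel, (key d h hb hc).2] at hs₂
    exact ⟨⟨hb, hs₁⟩, ⟨hc, hs₂⟩⟩

variable (T φ) in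
theorem preimage_membSet (a : S) :
    DSet.pi ⁻¹' (Subtype.val ⁻¹' membSet L S a) =
      dBasic L S T φ (⊤ : L.Formula (Fin n ⊕ Fin 1)) fun _ => a := by
  ext d
  exact ⟨fun h => ⟨fun _ => h, d.str.sat_top _⟩, fun h => h.1 0⟩

variable (T φ) in
theorem preimage_fSet {m : ℕ} (ψ : L.Formula (Fin m)) (b : Fin m → S) :
    DSet.pi ⁻¹' (Subtype.val ⁻¹' fSet L S ψ b) = dBasic L S T φ (ψ.relabel Sum.inr) b := by
  ext d
  exact exists_congr fun h =>
    (d.str.sat_relabel ψ Sum.inr (Sum.elim d.tup fun j => d.str.cls (b j) (h j))).symm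

variable (T φ) in
theorem secImage_eq_iInter (a : Fin n → S) :
    secImage L S T φ a = ⋂ i, dBasic L S T φ
      (Term.equal (Term.var (.inl i)) (Term.var (.inr (0 : Fin 1)))) fun _ => a i := by
  ext d
  rw [mem_iInter]
  constructor
  · rintro ⟨h, hd⟩ i
    exact ⟨fun _ => h i, (d.str.sat_equal_var _ _ _).2 (congrFun hd i)⟩
  · intro h
    exact ⟨fun i => (h i).1 0, funext fun i => (d.str.sat_equal_var _ _ _).1 (h i).2⟩

end DSet

theorem stmt11 (T : Set L.Sentence) {n : ℕ} (φ : L.Formula (Fin n)) :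
    IsTopologicalBasis {U : Set (DSet L S T φ) |
      ∃ (m : ℕ) (ψ : L.Formula (Fin n ⊕ Fin m)), IsHorn ψ ∧
        ∃ b : Fin m → S, U = dBasic L S T φ ψ b} := by
  refine ⟨?_, ?_, le_antisymm (le_generateFrom ?_) (le_inf ?_ (le_generateFrom ?_))⟩
  · rintro _ ⟨m, ψ, hψ, b, rfl⟩ _ ⟨k, χ, hχ, c, rfl⟩ d hd
    exact ⟨_, ⟨_, _, (hψ.relabel _).inf (hχ.relabel _), _, dBasic_inter T φ ψ χ b c⟩, hd,
      Subset.rfl⟩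
  · refine eq_univ_of_forall fun d => mem_sUnion.2 ⟨_, ⟨0, ⊤, .top, Fin.elim0, rfl⟩, ?_⟩
    exact ⟨fun j => j.elim0, d.str.sat_top _⟩
  · rintro _ ⟨m, ψ, hψ, b, rfl⟩
    exact hψ.isOpen_dBasic b
  · rw [← continuous_iff_le_induced, continuous_induced_rng]
    refine continuous_generateFrom_iff.2 ?_
    rintro _ (⟨a, rfl⟩ | ⟨m, ψ, hψ, b, rfl⟩)
    · exact isOpen_generateFrom_of_mem ⟨_, _, .top, _, preimage_membSet T φ a⟩
    · exact isOpen_generateFrom_of_mem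
        ⟨_, _, (IsHorn.of_isAtomic hψ).relabel _, _, preimage_fSet T φ ψ b⟩
  · rintro _ ⟨a, rfl⟩
    rw [secImage_eq_iInter]
    exact @isOpen_iInter_of_finite _ _ (generateFrom _) _ _ fun i =>
      isOpen_generateFrom_of_mem ⟨_, _, .equal _ _, _, rfl⟩

end SemGpd
end
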